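/- The composed map (b_1, a_1, b_2, a_2, …, b_n, a_n) ↦ (u^{(2n)}_{2n−1}, u^{(2n)}_{2n−2}, …, u^{(2n)}_0) sending the Jacobi coefficients to the coefficients of the Geronimo–Case polynomial L*_{2n} has Jacobian determinant (in absolute value) equal to 2^n · ∏_{j=1}^n a_j^{2j−1}. -/

import Mathlib

open Polynomial Finset

/-- Geronimo–Case recursion: `(GC a b m).1 = L*_m`, `(GC a b m).2 = K_m`. -/
noncomputable def GC (a b : ℕ → ℝ) : ℕ → Polynomial ℝ × Polynomial ℝ
  | 0 => (1, 1)
  | m + 1 =>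
      let p := GC a b m
      if m % 2 = 0 then
        (Polynomial.X * p.1 - Polynomial.C (b (m / 2 + 1)) * p.2, p.2)
      else
        (Polynomial.X * p.1 - Polynomial.C ((a (m / 2 + 1)) ^ 2 - 1) * p.2,
         Polynomial.X * p.1 + p.2)

/-- The entry `a_j` (for `1 ≤ j ≤ n`) read off from the vector
`(b_1, a_1, b_2, a_2, …, b_n, a_n)`. -/
def aOf (n : ℕ) (v : Fin (2 * n) → ℝ) (i : ℕ) : ℝ :=
  if h : 1 ≤ i ∧ 2 * i - 1 < 2 * n then v ⟨2 * i - 1, h.2⟩ else 1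

/-- The entry `b_j` (for `1 ≤ j ≤ n`) read off from the vector
`(b_1, a_1, b_2, a_2, …, b_n, a_n)`. -/
def bOf (n : ℕ) (v : Fin (2 * n) → ℝ) (i : ℕ) : ℝ :=
  if h : 1 ≤ i ∧ 2 * i - 2 < 2 * n then v ⟨2 * i - 2, h.2⟩ else 0

/-- The map `(b_1, a_1, …, b_n, a_n) ↦ (u^{(2n)}_0, …, u^{(2n)}_{2n-1})` sending the Jacobi
coefficients to the coefficients of the Geronimo–Case polynomial `L*_{2n}`. -/
noncomputable def jacobiToCoeff (n : ℕ) (v : Fin (2 * n) → ℝ) : Fin (2 * n) → ℝ :=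
  fun j => ((GC (aOf n v) (bOf n v) (2 * n)).1).coeff (j : ℕ)


noncomputable def kr (a b : ℕ → ℝ) : ℕ → (ℤ → ℝ) × (ℤ → ℝ)
  | 0 => (fun m => if m = 0 then 1 else 0, fun _ => 0)
  | k + 1 =>
      (fun m => (kr a b k).1 (m - 1) + (kr a b k).1 (m + 1) - b (k + 1) * (kr a b k).1 m
        - (kr a b k).2 m,
       fun m => a (k + 1) ^ 2 * (kr a b k).1 m)

theorem kr_supp (a b : ℕ → ℝ) (k : ℕ) :
    (∀ m : ℤ, k < m.natAbs → (kr a b k).1 m = 0) ∧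
    (∀ m : ℤ, m.natAbs = k → (kr a b k).1 m = 1) ∧
    (∀ m : ℤ, k ≤ m.natAbs → (kr a b k).2 m = 0) ∧
    (∀ m : ℤ, (kr a b k).1 (-m) = (kr a b k).1 m) ∧
    (∀ m : ℤ, (kr a b k).2 (-m) = (kr a b k).2 m) := by
  induction k with
  | zero =>
    refine ⟨?_, ?_, ?_, ?_, ?_⟩ <;> intro m <;> simp [kr]
  | succ k ih =>
    obtain ⟨h1, h2, h3, h4, h5⟩ := ih
    refine ⟨?_, ?_, ?_, ?_, ?_⟩
    · intro m hm
      simp only [kr]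
      rw [h1 _ (by omega), h1 _ (by omega), h1 _ (by omega), h3 _ (by omega)]; simp
    · intro m hm
      simp only [kr]
      rcases le_total 0 m with h | h
      · rw [h2 (m - 1) (by omega), h1 _ (by omega), h1 _ (by omega), h3 _ (by omega)]; simp
      · rw [h2 (m + 1) (by omega), h1 _ (by omega), h1 _ (by omega), h3 _ (by omega)]; simp
    · intro m hm
      simp only [kr]
      rw [h1 _ (by omega)]; simp
    · intro m
      simp only [kr]
      rw [h4 m, h5 m, show -m - 1 = -(m + 1) by ring, show -m + 1 = -(m - 1) by ring, h4, h4]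
      ring
    · intro m
      simp only [kr]
      rw [h4]

theorem GC_coeff (a b : ℕ → ℝ) (k : ℕ) : ∀ j : ℕ,
    (GC a b (2 * k)).2.coeff j = (kr a b k).1 ((j : ℤ) - k) ∧
    (GC a b (2 * k)).1.coeff j = (kr a b k).1 ((j : ℤ) - k) - (kr a b k).2 ((j : ℤ) - k + 1) := by
  induction k with
  | zero => intro j; simp [GC, kr, Polynomial.coeff_one]
  | succ k ih =>
    obtain ⟨h1, h2, h3, h4, h5⟩ := kr_supp a b k
    have e1 : (GC a b (2 * (k + 1))).2 = X * (X * (GC a b (2 * k)).1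
        - C (b (k + 1)) * (GC a b (2 * k)).2) + (GC a b (2 * k)).2 := by
      rw [show 2 * (k + 1) = 2 * k + 1 + 1 by ring]
      simp only [GC]
      rw [if_neg (by omega), if_pos (by omega), show 2 * k / 2 = k by omega]
    have e2 : (GC a b (2 * (k + 1))).1 = (GC a b (2 * (k + 1))).2
        - C (a (k + 1) ^ 2) * (GC a b (2 * k)).2 := by
      rw [e1]
      rw [show 2 * (k + 1) = 2 * k + 1 + 1 by ring]
      simp only [GC]
      rw [if_neg (by omega), if_pos (by omega), show 2 * k / 2 = k by omega,
        show (2 * k + 1) / 2 = k by omega]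
      simp only [C_sub, C_1]
      ring
    have key : ∀ j : ℕ, (GC a b (2 * (k + 1))).2.coeff j
        = (kr a b (k + 1)).1 ((j : ℤ) - (k + 1 : ℕ)) := by
      intro j
      rw [e1]
      simp only [kr]
      rcases j with _ | _ | j
      · simp only [coeff_add, coeff_X_mul_zero]
        rw [(ih 0).1, h1 (((0 : ℕ) : ℤ) - ((k + 1 : ℕ) : ℤ) - 1) (by push_cast; omega),
          h1 (((0 : ℕ) : ℤ) - ((k + 1 : ℕ) : ℤ)) (by push_cast; omega),
          h3 _ (by push_cast; omega)]
        push_cast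
        ring_nf
      · simp only [coeff_add, coeff_X_mul, zero_add, coeff_sub, coeff_X_mul_zero, coeff_C_mul]
        rw [(ih 0).1, (ih 1).1, h1 (_ - 1) (by push_cast; omega), h3 _ (by push_cast; omega)]
        push_cast
        ring_nf
      · simp only [coeff_add, coeff_X_mul, coeff_sub, coeff_C_mul]
        rw [(ih _).1, (ih _).1, (ih _).2]
        push_cast
        ring_nf
    intro j
    refine ⟨key j, ?_⟩
    rw [e2, coeff_sub, key, coeff_C_mul, (ih j).1]
    congr 1
    simp only [kr]
    push_cast
    ring_nf

abbrev VV (n : ℕ) := Fin n ⊕ Fin n → ℝ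

noncomputable def Pe (n k : ℕ) (s : VV n) (m : ℤ) : ℝ :=
  if h : m.natAbs < k ∧ m.natAbs < n then s (Sum.inl ⟨m.natAbs, h.2⟩)
  else if m.natAbs = k then 1 else 0

noncomputable def Re (n k : ℕ) (s : VV n) (m : ℤ) : ℝ :=
  if h : m.natAbs < k ∧ m.natAbs < n then s (Sum.inr ⟨m.natAbs, h.2⟩) else 0

noncomputable def dPe (n k : ℕ) (m : ℤ) : VV n →L[ℝ] ℝ :=
  if h : m.natAbs < k ∧ m.natAbs < n then ContinuousLinearMap.proj (Sum.inl ⟨m.natAbs, h.2⟩) else 0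

noncomputable def dRe (n k : ℕ) (m : ℤ) : VV n →L[ℝ] ℝ :=
  if h : m.natAbs < k ∧ m.natAbs < n then ContinuousLinearMap.proj (Sum.inr ⟨m.natAbs, h.2⟩) else 0

theorem hasPe (n k : ℕ) (s : VV n) (m : ℤ) :
    HasFDerivAt (fun s => Pe n k s m) (dPe n k m) s := by
  unfold Pe dPe
  split_ifs with h h2
  · exact hasFDerivAt_apply _ _
  · exact hasFDerivAt_const _ _
  · exact hasFDerivAt_const _ _

theorem hasRe (n k : ℕ) (s : VV n) (m : ℤ) :
    HasFDerivAt (fun s => Re n k s m) (dRe n k m) s := by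
  unfold Re dRe
  split_ifs with h
  · exact hasFDerivAt_apply _ _
  · exact hasFDerivAt_const _ _

noncomputable def TT (n k : ℕ) (hk : k < n) (s : VV n) : VV n :=
  Sum.elim
    (fun i => if i.1 ≤ k then s (Sum.inl ⟨k, hk⟩) ^ 2 * Pe n k s i.1 else s (Sum.inl i))
    (fun i => if i.1 ≤ k then Pe n k s ((i.1 : ℤ) - 1) + Pe n k s ((i.1 : ℤ) + 1)
      - s (Sum.inr ⟨k, hk⟩) * Pe n k s i.1 - Re n k s i.1 else s (Sum.inr i))

noncomputable def dTT (n k : ℕ) (hk : k < n) (s : VV n) : VV n →L[ℝ] VV n :=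
  ContinuousLinearMap.pi (Sum.elim
    (fun i => if i.1 ≤ k then
        (2 * s (Sum.inl ⟨k, hk⟩) * Pe n k s i.1) • ContinuousLinearMap.proj (Sum.inl ⟨k, hk⟩)
        + s (Sum.inl ⟨k, hk⟩) ^ 2 • dPe n k i.1
      else ContinuousLinearMap.proj (Sum.inl i))
    (fun i => if i.1 ≤ k then
        dPe n k ((i.1 : ℤ) - 1) + dPe n k ((i.1 : ℤ) + 1)
        - (s (Sum.inr ⟨k, hk⟩) • dPe n k i.1
          + Pe n k s i.1 • ContinuousLinearMap.proj (Sum.inr ⟨k, hk⟩)) - dRe n k i.1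
      else ContinuousLinearMap.proj (Sum.inr i)))

theorem hasTT (n k : ℕ) (hk : k < n) (s : VV n) :
    HasFDerivAt (TT n k hk) (dTT n k hk s) s := by
  unfold dTT
  rw [hasFDerivAt_pi']
  rintro (i | i)
  · rw [ContinuousLinearMap.proj_pi]
    simp only [TT, Sum.elim_inl]
    split_ifs with h
    · have h1 : HasFDerivAt (fun s : VV n => s (Sum.inl ⟨k, hk⟩))
        (ContinuousLinearMap.proj (R := ℝ) (Sum.inl ⟨k, hk⟩)) s := hasFDerivAt_apply _ _
      refine ((h1.pow 2).mul (hasPe n k s i.1)).congr_fderiv ?_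
      ext w
      simp
      ring
    · exact hasFDerivAt_apply _ _
  · rw [ContinuousLinearMap.proj_pi]
    simp only [TT, Sum.elim_inr]
    split_ifs with h
    · have h1 : HasFDerivAt (fun s : VV n => s (Sum.inr ⟨k, hk⟩))
        (ContinuousLinearMap.proj (R := ℝ) (Sum.inr ⟨k, hk⟩)) s := hasFDerivAt_apply _ _
      exact (((hasPe n k s _).add (hasPe n k s _)).sub (h1.mul (hasPe n k s i.1))).sub
        (hasRe n k s _)
    · exact hasFDerivAt_apply _ _

theorem prod_aux (x : ℝ) (k n : ℕ) (hk : k < n) :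
    ∏ i : Fin n, (if i.1 < k then x ^ 2 else if i.1 = k then 2 * x else 1)
      = 2 * x ^ (2 * k + 1) := by
  rw [Fin.prod_univ_eq_prod_range (fun i => if i < k then x ^ 2 else if i = k then 2 * x else 1)]
  induction n, hk using Nat.le_induction with
  | base =>
    rw [Finset.prod_range_succ, Finset.prod_congr rfl (g := fun _ => x ^ 2)]
    · simp; ring
    · intro i hi; rw [if_pos (Finset.mem_range.1 hi)]
  | succ n hn ih =>
    rw [Finset.prod_range_succ, ih, if_neg (by omega), if_neg (by omega), mul_one]

theorem dPe_inr (n k : ℕ) (m : ℤ) (j : Fin n) : dPe n k m (Pi.single (Sum.inr j) 1) = 0 := by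
  unfold dPe; split_ifs <;> simp

theorem dPe_inl (n k : ℕ) (i j : Fin n) : dPe n k i.1 (Pi.single (Sum.inl j) 1)
    = if i.1 < k ∧ i = j then 1 else 0 := by
  unfold dPe
  rcases i with ⟨i, hi⟩
  by_cases h : i < k <;> simp [h, hi, Pi.single_apply]

theorem dRe_inr (n k : ℕ) (i j : Fin n) : dRe n k i.1 (Pi.single (Sum.inr j) 1)
    = if i.1 < k ∧ i = j then 1 else 0 := by
  unfold dRe
  rcases i with ⟨i, hi⟩
  by_cases h : i < k <;> simp [h, hi, Pi.single_apply]

theorem det_dTT (n k : ℕ) (hk : k < n) (s : VV n) :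
    |(LinearMap.toMatrix' (dTT n k hk s).toLinearMap).det|
      = |2 * s (Sum.inl ⟨k, hk⟩) ^ (2 * k + 1)| := by
  set M := LinearMap.toMatrix' (dTT n k hk s).toLinearMap with hM
  have h12 : M.toBlocks₁₂ = 0 := by
    ext i j
    simp only [hM, Matrix.toBlocks₁₂, Matrix.of_apply, LinearMap.toMatrix'_apply, dTT]
    by_cases h : i.1 ≤ k <;> simp [h, dPe_inr]
  have e11 : ∀ i j, M.toBlocks₁₁ i j = if i.1 ≤ k then
      (2 * s (Sum.inl ⟨k, hk⟩) * Pe n k s i.1) * (if ⟨k, hk⟩ = j then 1 else 0)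
      + s (Sum.inl ⟨k, hk⟩) ^ 2 * (if i.1 < k ∧ i = j then 1 else 0)
      else if i = j then 1 else 0 := by
    intro i j
    simp only [hM, Matrix.toBlocks₁₁, Matrix.of_apply, LinearMap.toMatrix'_apply, dTT]
    by_cases h : i.1 ≤ k <;> simp [h, dPe_inl, Pi.single_apply]
  have e22 : ∀ i j, M.toBlocks₂₂ i j = if i.1 ≤ k then
      - (Pe n k s i.1 * (if ⟨k, hk⟩ = j then 1 else 0)) - (if i.1 < k ∧ i = j then 1 else 0)
      else if i = j then 1 else 0 := by
    intro i j
    simp only [hM, Matrix.toBlocks₂₂, Matrix.of_apply, LinearMap.toMatrix'_apply, dTT]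
    by_cases h : i.1 ≤ k <;> simp [h, dPe_inr, dRe_inr, Pi.single_apply]
  have hPk : Pe n k s (k : ℤ) = 1 := by simp [Pe]
  have t11 : M.toBlocks₁₁.BlockTriangular id := by
    intro i j hij
    simp only [id] at hij
    have hij' : j.1 < i.1 := hij
    rw [e11]
    split_ifs <;> simp_all [Fin.ext_iff] <;> omega
  have t22 : M.toBlocks₂₂.BlockTriangular id := by
    intro i j hij
    simp only [id] at hij
    have hij' : j.1 < i.1 := hij
    rw [e22]
    split_ifs <;> simp_all [Fin.ext_iff] <;> omega
  rw [← Matrix.fromBlocks_toBlocks M, h12, Matrix.det_fromBlocks_zero₁₂,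
    Matrix.det_of_isUpperTriangular t11, Matrix.det_of_isUpperTriangular t22, abs_mul,
    Finset.abs_prod (s := univ) (f := fun i => M.toBlocks₂₂ i i), ← prod_aux _ k n hk]
  rw [Finset.prod_eq_one (f := fun i => |M.toBlocks₂₂ i i|), mul_one]
  · congr 1
    refine Finset.prod_congr rfl fun i _ => ?_
    rw [e11]
    rcases lt_trichotomy i.1 k with h | h | h
    · simp [h, h.le, Fin.ext_iff, h.ne']
    · obtain ⟨i, hi⟩ := i
      dsimp only at h
      subst h
      simp [hPk]
    · simp [h.not_ge, h.not_gt, h.ne']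
  · intro i _
    rw [e22]
    rcases lt_trichotomy i.1 k with h | h | h
    · simp [h, h.le, Fin.ext_iff, h.ne']
    · obtain ⟨i, hi⟩ := i
      dsimp only at h
      subst h
      simp [hPk]
    · simp [h.not_ge]

def swpF (n k : ℕ) : Fin n ⊕ Fin n → Fin n ⊕ Fin n :=
  Sum.elim (fun i => if i.1 ≤ k then Sum.inr i else Sum.inl i)
    (fun i => if i.1 ≤ k then Sum.inl i else Sum.inr i)

theorem swpF_inv (n k : ℕ) : Function.Involutive (swpF n k) := by
  rintro (i | i) <;> by_cases h : i.1 ≤ k <;> simp [swpF, h]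

def swp (n k : ℕ) : Equiv.Perm (Fin n ⊕ Fin n) := (swpF_inv n k).toPerm

noncomputable def Phi (n : ℕ) : ℕ → VV n → VV n
  | 0 => fun s => s
  | k + 1 => fun s => if hk : k < n then fun i => TT n k hk (Phi n k s) (swp n k i) else Phi n k s

theorem Pe_kr (a b : ℕ → ℝ) (n k : ℕ) (hk : k ≤ n) (s : VV n)
    (h : ∀ i : Fin n, i.1 < k → s (Sum.inl i) = (kr a b k).1 i.1) (m : ℤ) :
    Pe n k s m = (kr a b k).1 m := by
  obtain ⟨h1, h2, h3, h4, h5⟩ := kr_supp a b k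
  unfold Pe
  split_ifs with hh hh2
  · rw [h _ hh.1]
    dsimp only
    rcases Int.natAbs_eq m with e | e
    · rw [← e]
    · rw [show (m.natAbs : ℤ) = -m by omega, h4]
  · rw [h2 m hh2]
  · rw [h1 m (by omega)]

theorem Re_kr (a b : ℕ → ℝ) (n k : ℕ) (hk : k ≤ n) (s : VV n)
    (h : ∀ i : Fin n, i.1 < k → s (Sum.inr i) = (kr a b k).2 i.1) (m : ℤ) :
    Re n k s m = (kr a b k).2 m := by
  obtain ⟨h1, h2, h3, h4, h5⟩ := kr_supp a b k
  unfold Re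
  split_ifs with hh
  · rw [h _ hh.1]
    dsimp only
    rcases Int.natAbs_eq m with e | e
    · rw [← e]
    · rw [show (m.natAbs : ℤ) = -m by omega, h5]
  · rw [h3 m (by omega)]

theorem Phi_eq (a b : ℕ → ℝ) (n : ℕ) (s : VV n)
    (ha : ∀ i : Fin n, s (Sum.inl i) = a (i.1 + 1)) (hb : ∀ i : Fin n, s (Sum.inr i) = b (i.1 + 1))
    (k : ℕ) (hk : k ≤ n) :
    (∀ i : Fin n, Phi n k s (Sum.inl i) = if i.1 < k then (kr a b k).1 i.1 else a (i.1 + 1)) ∧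
    (∀ i : Fin n, Phi n k s (Sum.inr i) = if i.1 < k then (kr a b k).2 i.1 else b (i.1 + 1)) := by
  induction k with
  | zero => simp [Phi, ha, hb]
  | succ k ih =>
    obtain ⟨i1, i2⟩ := ih (by omega)
    have hP := Pe_kr a b n k (by omega) (Phi n k s) (fun i hi => by rw [i1, if_pos hi])
    have hR := Re_kr a b n k (by omega) (Phi n k s) (fun i hi => by rw [i2, if_pos hi])
    have hk' : k < n := hk
    constructor
    · intro i
      by_cases h : i.1 ≤ k
      · simp [Phi, hk', swp, swpF, h, TT, hP, hR, i2, kr]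
      · simp [Phi, hk', swp, swpF, h, TT, i1]
        omega
    · intro i
      by_cases h : i.1 ≤ k
      · simp [Phi, hk', swp, swpF, h, TT, hP, i1, kr]
      · simp [Phi, hk', swp, swpF, h, TT, i2]
        omega

noncomputable def permL {α β : Type} (e : α → β) : (β → ℝ) →L[ℝ] (α → ℝ) :=
  ContinuousLinearMap.pi fun i => ContinuousLinearMap.proj (e i)

theorem Phi_deriv (a b : ℕ → ℝ) (n : ℕ) (s : VV n)
    (ha : ∀ i : Fin n, s (Sum.inl i) = a (i.1 + 1)) (hb : ∀ i : Fin n, s (Sum.inr i) = b (i.1 + 1))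
    (k : ℕ) (hk : k ≤ n) :
    ∃ D : VV n →L[ℝ] VV n, HasFDerivAt (Phi n k) D s ∧
      |(LinearMap.toMatrix' D.toLinearMap).det|
        = ∏ j ∈ Finset.range k, |2 * a (j + 1) ^ (2 * j + 1)| := by
  induction k with
  | zero =>
    refine ⟨ContinuousLinearMap.id ℝ _, hasFDerivAt_id s, ?_⟩
    simp
  | succ k ih =>
    obtain ⟨D, hD, hdet⟩ := ih (by omega)
    have hk' : k < n := hk
    refine ⟨(permL (swp n k)).comp ((dTT n k hk' (Phi n k s)).comp D), ?_, ?_⟩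
    · have h1 := (permL (swp n k)).hasFDerivAt.comp s ((hasTT n k hk' (Phi n k s)).comp s hD)
      have h2 : Phi n (k + 1) = (permL (swp n k)) ∘ TT n k hk' ∘ Phi n k := by
        funext t
        simp only [Phi, hk', dif_pos]
        rfl
      rw [h2]
      exact h1
    · have : LinearMap.toMatrix' ((permL (swp n k)).comp
          ((dTT n k hk' (Phi n k s)).comp D)).toLinearMap
          = ((LinearMap.toMatrix' (dTT n k hk' (Phi n k s)).toLinearMap) *
            (LinearMap.toMatrix' D.toLinearMap)).submatrix (swp n k) (Equiv.refl _) := by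
        rw [← LinearMap.toMatrix'_comp]
        ext i j
        simp [LinearMap.toMatrix'_apply, permL]
      rw [this, Matrix.abs_det_submatrix_equiv_equiv, Matrix.det_mul, abs_mul, det_dTT, hdet,
        Finset.prod_range_succ, mul_comm, (Phi_eq a b n s ha hb k (by omega)).1]
      simp

noncomputable def Lam (n : ℕ) (s : VV n) : VV n :=
  Sum.elim (fun i => Pe n n s i.1 - Re n n s ((i.1 : ℤ) + 1))
    (fun i => Pe n n s ((i.1 : ℤ) + 1) - Re n n s i.1)

noncomputable def dLam (n : ℕ) : VV n →L[ℝ] VV n :=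
  ContinuousLinearMap.pi (Sum.elim (fun i => dPe n n i.1 - dRe n n ((i.1 : ℤ) + 1))
    (fun i => dPe n n ((i.1 : ℤ) + 1) - dRe n n i.1))

theorem hasLam (n : ℕ) (s : VV n) : HasFDerivAt (Lam n) (dLam n) s := by
  unfold dLam
  rw [hasFDerivAt_pi']
  rintro (i | i)
  · rw [ContinuousLinearMap.proj_pi]
    exact (hasPe n n s _).sub (hasRe n n s _)
  · rw [ContinuousLinearMap.proj_pi]
    exact (hasPe n n s _).sub (hasRe n n s _)

theorem dRe_inl (n k : ℕ) (m : ℤ) (j : Fin n) : dRe n k m (Pi.single (Sum.inl j) 1) = 0 := by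
  unfold dRe; split_ifs <;> simp

theorem dPe_inl' (n : ℕ) (i j : Fin n) : dPe n n ((i.1 : ℤ) + 1) (Pi.single (Sum.inl j) 1)
    = if i.1 + 1 = j.1 then 1 else 0 := by
  unfold dPe
  have : ((i.1 : ℤ) + 1).natAbs = i.1 + 1 := by omega
  simp only [this]
  split_ifs with h1 h2 h2 <;> simp [Pi.single_apply, Fin.ext_iff, h2]
  omega

theorem dRe_inr' (n : ℕ) (i j : Fin n) : dRe n n ((i.1 : ℤ) + 1) (Pi.single (Sum.inr j) 1)
    = if i.1 + 1 = j.1 then 1 else 0 := by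
  unfold dRe
  have : ((i.1 : ℤ) + 1).natAbs = i.1 + 1 := by omega
  simp only [this]
  split_ifs with h1 h2 h2 <;> simp [Pi.single_apply, Fin.ext_iff, h2]
  omega

theorem det_dLam (n : ℕ) : |(LinearMap.toMatrix' (dLam n).toLinearMap).det| = 1 := by
  let S : Matrix (Fin n) (Fin n) ℝ := Matrix.of fun i j => if i.1 + 1 = j.1 then 1 else 0
  have : LinearMap.toMatrix' (dLam n).toLinearMap = Matrix.fromBlocks 1 (-S) S (-1) := by
    ext i j
    rcases i with i | i <;> rcases j with j | j <;>
      simp [LinearMap.toMatrix'_apply, dLam, dPe_inr, dRe_inl, dPe_inl, dRe_inr, dPe_inl', dRe_inr',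
        S, Matrix.one_apply]
  have e : ∀ i j : Fin n, j ≤ i → (-1 - S * (-S)) i j = if i = j then -1 else 0 := by
    intro i j hij
    have hz : (S * S) i j = 0 := by
      rw [Matrix.mul_apply]
      refine Finset.sum_eq_zero fun l _ => ?_
      have : j.1 ≤ i.1 := hij
      simp only [S, Matrix.of_apply]
      split_ifs <;> first | omega | simp
    rw [Matrix.mul_neg, sub_neg_eq_add, Matrix.add_apply, hz, Matrix.neg_apply, Matrix.one_apply]
    split_ifs <;> simp
  have t : (-1 - S * (-S)).BlockTriangular id := by
    intro i j hij
    have hij' : j < i := hij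
    rw [e i j hij'.le, if_neg hij'.ne']
  rw [this, Matrix.det_fromBlocks_one₁₁, Matrix.det_of_isUpperTriangular t, Finset.abs_prod]
  refine Finset.prod_eq_one fun i _ => ?_
  rw [e i i le_rfl]
  simp

def eIn (n : ℕ) : Fin n ⊕ Fin n → Fin (2 * n) :=
  Sum.elim (fun i => ⟨2 * i.1 + 1, by omega⟩) (fun i => ⟨2 * i.1, by omega⟩)

def eOut (n : ℕ) : Fin n ⊕ Fin n → Fin (2 * n) :=
  Sum.elim (fun i => ⟨n + i.1, by omega⟩) (fun i => ⟨n - 1 - i.1, by omega⟩)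

theorem eIn_bij (n : ℕ) : Function.Bijective (eIn n) := by
  rw [Fintype.bijective_iff_injective_and_card]
  refine ⟨?_, by simp; omega⟩
  rintro (i | i) (j | j) h <;> simp [eIn, Fin.ext_iff] at h ⊢ <;> omega

theorem eOut_bij (n : ℕ) : Function.Bijective (eOut n) := by
  rw [Fintype.bijective_iff_injective_and_card]
  refine ⟨?_, by simp; omega⟩
  rintro (i | i) (j | j) h <;> simp [eOut, Fin.ext_iff] at h ⊢ <;> omega

theorem main_eq (n : ℕ) (v : Fin (2 * n) → ℝ) (i : Fin n ⊕ Fin n) :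
    jacobiToCoeff n v (eOut n i) = Lam n (Phi n n (fun t => v (eIn n t))) i := by
  obtain ⟨h1, h2⟩ := Phi_eq (aOf n v) (bOf n v) n (fun t => v (eIn n t))
    (fun i => by
      have := i.2
      rw [aOf, dif_pos ⟨by omega, by omega⟩]
      congr 1)
    (fun i => by
      have := i.2
      rw [bOf, dif_pos ⟨by omega, by omega⟩]
      congr 1) n le_rfl
  have hP := Pe_kr (aOf n v) (bOf n v) n n le_rfl (Phi n n (fun t => v (eIn n t))) (fun i hi => by rw [h1, if_pos hi])
  have hR := Re_kr (aOf n v) (bOf n v) n n le_rfl (Phi n n (fun t => v (eIn n t))) (fun i hi => by rw [h2, if_pos hi])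
  obtain ⟨_, _, _, h4, h5⟩ := kr_supp (aOf n v) (bOf n v) n
  unfold jacobiToCoeff
  rw [(GC_coeff _ _ n _).2]
  rcases i with i | i
  · simp only [Lam, Sum.elim_inl, hP, hR, eOut]
    push_cast
    ring_nf
  · simp only [Lam, Sum.elim_inr, hP, hR, eOut]
    have : ((n - 1 - i.1 : ℕ) : ℤ) = n - 1 - i.1 := by have := i.2; omega
    rw [this, ← h4 ((i.1 : ℤ) + 1), ← h5 (i.1 : ℤ)]
    ring_nf

theorem geronimo_case_jacobian_full (n : ℕ) (v : Fin (2 * n) → ℝ)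
    (ha : ∀ i, 1 ≤ i → i ≤ n → 0 < aOf n v i) :
    |LinearMap.det ((fderiv ℝ (jacobiToCoeff n) v).toLinearMap)| =
      2 ^ n * ∏ j ∈ Finset.Icc 1 n, (aOf n v j) ^ (2 * j - 1) := by
  obtain ⟨D, hD, hdet⟩ := Phi_deriv (aOf n v) (bOf n v) n (permL (eIn n) v)
    (fun i => by
      have := i.2
      rw [aOf, dif_pos ⟨by omega, by omega⟩]
      simp only [permL, ContinuousLinearMap.coe_pi', ContinuousLinearMap.proj_apply]
      congr 1)
    (fun i => by
      have := i.2
      rw [bOf, dif_pos ⟨by omega, by omega⟩]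
      simp only [permL, ContinuousLinearMap.coe_pi', ContinuousLinearMap.proj_apply]
      congr 1) n le_rfl
  let eo := Equiv.ofBijective _ (eOut_bij n)
  let ei := Equiv.ofBijective _ (eIn_bij n)
  have hF : HasFDerivAt (jacobiToCoeff n)
      ((permL eo.symm).comp ((dLam n).comp (D.comp (permL (eIn n))))) v := by
    have h1 := (permL eo.symm).hasFDerivAt.comp v
      ((hasLam n _).comp v (hD.comp v (permL (eIn n)).hasFDerivAt))
    refine h1.congr_of_eventuallyEq (Filter.Eventually.of_forall fun w => ?_)
    funext j
    obtain ⟨i, rfl⟩ := eo.surjective j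
    have := main_eq n w i
    change jacobiToCoeff n w (eOut n i) = Lam n (Phi n n (fun t => w (eIn n t))) (eo.symm (eo i))
    rw [this, Equiv.symm_apply_apply]
  have hM : LinearMap.toMatrix' ((permL eo.symm).comp
      ((dLam n).comp (D.comp (permL (eIn n))))).toLinearMap
      = ((LinearMap.toMatrix' (dLam n).toLinearMap) *
        (LinearMap.toMatrix' D.toLinearMap)).submatrix eo.symm ei.symm := by
    rw [← LinearMap.toMatrix'_comp]
    ext i j
    have : permL (eIn n) (Pi.single j 1) = Pi.single (ei.symm j) 1 := by
      ext t
      obtain ⟨u, rfl⟩ := ei.surjective j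
      simp only [permL, ContinuousLinearMap.coe_pi', ContinuousLinearMap.proj_apply,
        Equiv.symm_apply_apply, Pi.single_apply]
      have : eIn n t = ei u ↔ t = u := ei.injective.eq_iff (a := t)
      simp only [this]
    simp only [LinearMap.toMatrix'_apply, Matrix.submatrix_apply, ContinuousLinearMap.coe_coe,
      ContinuousLinearMap.comp_apply, LinearMap.comp_apply, this]
    rfl
  rw [hF.fderiv, ← LinearMap.det_toMatrix', hM, Matrix.abs_det_submatrix_equiv_equiv,
    Matrix.det_mul, abs_mul, det_dLam, hdet, one_mul]
  have hprod : ∀ m, m ≤ n → ∏ j ∈ Finset.range m, |2 * aOf n v (j + 1) ^ (2 * j + 1)|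
      = 2 ^ m * ∏ j ∈ Finset.Icc 1 m, (aOf n v j) ^ (2 * j - 1) := by
    intro m hm
    induction m with
    | zero => simp
    | succ m ih =>
      have hpos := ha (m + 1) (by omega) hm
      rw [Finset.prod_range_succ, ih (by omega), Finset.prod_Icc_succ_top (by omega),
        abs_of_pos (by positivity), show 2 * (m + 1) - 1 = 2 * m + 1 by omega]
      ring
  exact hprod n le_rfl
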